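/- Let q ≥ 1 and n > 2q. Let ρ : [0,∞) → [0,∞) be continuously differentiable with ρ′(s) ≤ 0 for all s ≥ 0 and ρ(s) ≥ c for some constant c > 0. Let ω be a measurable family of alternating q-forms on ℝⁿ such that e(Q) is locally integrable, and assume the first-variation identity: for every smooth nonnegative nonincreasing η : [0,∞) → ℝ with compact support, ∫_{ℝⁿ} e(Q(x)) (n·η(|x|) + |x|·η′(|x|)) dx = 2q ∫_{ℝⁿ} Q(x) ρ(Q(x)) η(|x|) dx + 2q ∫_{ℝⁿ} ρ(Q(x)) |x| η′(|x|) ‖∂_r⌟ω(x)‖² dx. Suppose further there exist constants C > 0 and k ≥ 0 with 2q + k − n < 0 such that ∫_{B_r} e(Q(x)) dx ≤ C·r^k for all r ≥ 1. Then Q(x) = 0 for almost every x ∈ ℝⁿ. -/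

import Mathlib

open MeasureTheory Metric

/-- The squared norm of an alternating `q`-linear form on `ℝⁿ` induced by the standard
inner product: `Q = Σ_{i₁<⋯<i_q} ω(e_{i₁},…,e_{i_q})²`. -/
noncomputable def altNormSq {n q : ℕ}
    (α : AlternatingMap ℝ (EuclideanSpace ℝ (Fin n)) ℝ (Fin q)) : ℝ :=
  ∑ f ∈ Finset.univ.filter (fun f : Fin q → Fin n => ∀ i j : Fin q, i < j → f i < f j),
    (α fun i => EuclideanSpace.single (f i) (1:ℝ)) ^ 2

/-- The squared norm of the contraction `u⌟α` of an alternating `q`-linear form `α`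
with a vector `u`, i.e. of the `(q−1)`-form `(v₂,…,v_q) ↦ α(u, v₂, …, v_q)`. -/
noncomputable def contrNormSq {n q : ℕ} (u : EuclideanSpace ℝ (Fin n))
    (α : AlternatingMap ℝ (EuclideanSpace ℝ (Fin n)) ℝ (Fin q)) : ℝ :=
  ∑ g ∈ Finset.univ.filter
      (fun g : Fin (q - 1) → Fin n => ∀ i j : Fin (q - 1), i < j → g i < g j),
    (α fun i : Fin q => if h : (i : ℕ) = 0 then u
        else EuclideanSpace.single (g ⟨(i : ℕ) - 1, by have := i.isLt; omega⟩) (1:ℝ)) ^ 2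

/-- The nonlinear Hodge energy density `e(s) = ∫₀ˢ ρ(t) dt`. -/
noncomputable def hodgeE (ρ : ℝ → ℝ) (s : ℝ) : ℝ := ∫ t in (0:ℝ)..s, ρ t

lemma altNormSq_nonneg {n q : ℕ}
    (α : AlternatingMap ℝ (EuclideanSpace ℝ (Fin n)) ℝ (Fin q)) : 0 ≤ altNormSq α :=
  Finset.sum_nonneg fun _ _ => sq_nonneg _

lemma contrNormSq_nonneg {n q : ℕ} (u : EuclideanSpace ℝ (Fin n))
    (α : AlternatingMap ℝ (EuclideanSpace ℝ (Fin n)) ℝ (Fin q)) : 0 ≤ contrNormSq u α :=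
  Finset.sum_nonneg fun _ _ => sq_nonneg _

lemma mul_le_hodgeE {ρ : ℝ → ℝ} (hρ : Continuous ρ) (hanti : AntitoneOn ρ (Set.Ici 0))
    {s : ℝ} (hs : 0 ≤ s) : s * ρ s ≤ hodgeE ρ s := by
  have h := intervalIntegral.integral_mono_on (μ := volume) (f := fun _ => ρ s) (g := ρ) hs
    (continuous_const.intervalIntegrable 0 s) (hρ.intervalIntegrable 0 s)
    fun t ht => hanti ht.1 hs ht.2
  simpa [hodgeE] using h

lemma deriv_smoothTransition_of_neg {t : ℝ} (ht : t < 0) :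
    deriv Real.smoothTransition t = 0 := by
  have h : Real.smoothTransition =ᶠ[nhds t] fun _ => 0 := by
    filter_upwards [gt_mem_nhds ht] with x hx using Real.smoothTransition.zero_of_nonpos hx.le
  rw [h.deriv_eq, deriv_const]

lemma deriv_smoothTransition_of_one_lt {t : ℝ} (ht : 1 < t) :
    deriv Real.smoothTransition t = 0 := by
  have h : Real.smoothTransition =ᶠ[nhds t] fun _ => 1 := by
    filter_upwards [lt_mem_nhds ht] with x hx using Real.smoothTransition.one_of_one_le hx.le
  rw [h.deriv_eq, deriv_const]

lemma exists_abs_deriv_smoothTransition_le :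
    ∃ M : ℝ, 0 ≤ M ∧ ∀ t, |deriv Real.smoothTransition t| ≤ M := by
  have hcont : Continuous (deriv Real.smoothTransition) :=
    (Real.smoothTransition.contDiff (n := 1)).continuous_deriv le_rfl
  obtain ⟨M, hM⟩ := (isCompact_Icc (a := (0 : ℝ)) (b := 1)).exists_bound_of_continuousOn
    hcont.continuousOn
  have hM0 : 0 ≤ M := (norm_nonneg _).trans (hM 0 (by simp))
  refine ⟨M, hM0, fun t => ?_⟩
  rcases lt_or_ge t 0 with h0 | h0
  · simpa [deriv_smoothTransition_of_neg h0] using hM0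
  rcases lt_or_ge 1 t with h1 | h1
  · simpa [deriv_smoothTransition_of_one_lt h1] using hM0
  · exact hM t ⟨h0, h1⟩

/-- The radial weight `(1 + r²)^(-s/2)`, smoothly cut off between `r = R` and `r = 2R`. -/
noncomputable def radialCutoff (s R r : ℝ) : ℝ :=
  (1 + r ^ 2) ^ (-s / 2) * Real.smoothTransition (2 - r / R)

section radialCutoff

variable {s R : ℝ}

lemma contDiff_radialCutoff {m : ℕ∞} : ContDiff ℝ m (radialCutoff s R) := by
  unfold radialCutoff
  refine ContDiff.mul ?_ (Real.smoothTransition.contDiff.comp (by fun_prop))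
  exact ContDiff.rpow_const_of_ne (by fun_prop) fun x => by positivity

lemma radialCutoff_nonneg (r : ℝ) : 0 ≤ radialCutoff s R r :=
  mul_nonneg (by positivity) (Real.smoothTransition.nonneg _)

lemma antitoneOn_radialCutoff (hs : 0 ≤ s) (hR : 0 < R) :
    AntitoneOn (radialCutoff s R) (Set.Ici 0) := by
  intro a ha b hb hab
  have ha : 0 ≤ a := ha
  have h : Real.smoothTransition (2 - b / R) ≤ Real.smoothTransition (2 - a / R) :=
    Real.smoothTransition.monotone (by gcongr)
  refine mul_le_mul ?_ h (Real.smoothTransition.nonneg _) (by positivity)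
  exact Real.rpow_le_rpow_of_nonpos (by positivity) (by gcongr) (by linarith)

lemma radialCutoff_eq_zero (hR : 0 < R) {r : ℝ} (hr : 2 * R ≤ r) : radialCutoff s R r = 0 := by
  have : 2 ≤ r / R := (le_div_iff₀ hR).2 hr
  rw [radialCutoff, Real.smoothTransition.zero_of_nonpos (by linarith), mul_zero]

lemma le_radialCutoff (hs : 0 ≤ s) (hR : 0 < R) {r a : ℝ} (hr : 0 ≤ r) (hra : r ≤ a)
    (haR : a ≤ R) : (1 + a ^ 2) ^ (-s / 2) ≤ radialCutoff s R r := by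
  have : r / R ≤ 1 := (div_le_one hR).2 (hra.trans haR)
  rw [radialCutoff, Real.smoothTransition.one_of_one_le (by linarith), mul_one]
  exact Real.rpow_le_rpow_of_nonpos (by positivity) (by gcongr) (by linarith)

lemma hasDerivAt_radialCutoff (r : ℝ) :
    HasDerivAt (radialCutoff s R)
      (2 * r * (-s / 2) * (1 + r ^ 2) ^ (-s / 2 - 1) * Real.smoothTransition (2 - r / R)
        + (1 + r ^ 2) ^ (-s / 2) * (deriv Real.smoothTransition (2 - r / R) * -(1 / R))) r := by
  have h1 : HasDerivAt (fun r : ℝ => 1 + r ^ 2) (2 * r) r := by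
    simpa using (hasDerivAt_pow 2 r).const_add 1
  have h2 : HasDerivAt (fun r : ℝ => 2 - r / R) (-(1 / R)) r :=
    ((hasDerivAt_id r).div_const R).const_sub 2
  have h3 : HasDerivAt Real.smoothTransition (deriv Real.smoothTransition (2 - r / R))
      (2 - r / R) :=
    ((Real.smoothTransition.contDiff (n := 1)).differentiable one_ne_zero _).hasDerivAt
  exact (h1.rpow_const (p := -s / 2) (Or.inl (by positivity))).mul
    (HasDerivAt.comp (h₂ := Real.smoothTransition) r h3 h2)

lemma deriv_radialCutoff_eq_zero (hR : 0 < R) {r : ℝ} (hr : 3 * R ≤ r) :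
    deriv (radialCutoff s R) r = 0 := by
  have h : radialCutoff s R =ᶠ[nhds r] fun _ => 0 := by
    filter_upwards [lt_mem_nhds (show 2 * R < r by linarith)] with x hx
      using radialCutoff_eq_zero hR hx.le
  rw [h.deriv_eq, deriv_const]

lemma neg_le_mul_deriv_radialCutoff (hs : 0 ≤ s) (hR : 0 < R) {M : ℝ} (hM0 : 0 ≤ M)
    (hM : ∀ t, |deriv Real.smoothTransition t| ≤ M) {r : ℝ} (hr : 0 ≤ r) (hr3 : r < 3 * R) :
    -s * radialCutoff s R r - 3 * M * R ^ (-s) ≤ r * deriv (radialCutoff s R) r := by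
  rw [(hasDerivAt_radialCutoff r).deriv, radialCutoff]
  have hp : (0 : ℝ) < 1 + r ^ 2 := by positivity
  have hw : (1 + r ^ 2) * (1 + r ^ 2) ^ (-s / 2 - 1) = (1 + r ^ 2) ^ (-s / 2) := by
    rw [Real.rpow_sub_one hp.ne']
    field_simp
  set T := Real.smoothTransition (2 - r / R)
  have hT : 0 ≤ T := Real.smoothTransition.nonneg _
  have hW : 0 ≤ (1 + r ^ 2) ^ (-s / 2 - 1) := by positivity
  have hdecay : -s * ((1 + r ^ 2) ^ (-s / 2) * T)
      ≤ r * (2 * r * (-s / 2) * (1 + r ^ 2) ^ (-s / 2 - 1) * T) := by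
    rw [← hw]
    nlinarith [mul_nonneg hs (mul_nonneg hW hT)]
  have hcut : (1 + r ^ 2) ^ (-s / 2) * (r / R * deriv Real.smoothTransition (2 - r / R))
      ≤ 3 * M * R ^ (-s) := by
    rcases lt_or_ge r R with h | h
    · have : r / R < 1 := (div_lt_one hR).2 h
      rw [deriv_smoothTransition_of_one_lt (by linarith)]
      simp only [mul_zero]
      positivity
    · have h1 : (1 + r ^ 2) ^ (-s / 2) ≤ R ^ (-s) := by
        calc (1 + r ^ 2) ^ (-s / 2) ≤ (R ^ 2) ^ (-s / 2) :=
              Real.rpow_le_rpow_of_nonpos (by positivity) (by nlinarith) (by linarith)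
          _ = R ^ (-s) := by
              rw [← Real.rpow_natCast, ← Real.rpow_mul hR.le]
              congr 1
              push_cast
              ring
      have h2 : r / R * deriv Real.smoothTransition (2 - r / R) ≤ 3 * M :=
        mul_le_mul ((div_le_iff₀ hR).2 hr3.le) ((le_abs_self _).trans (hM _)) ?_ (by norm_num)
      · calc _ ≤ (1 + r ^ 2) ^ (-s / 2) * (3 * M) := by gcongr
          _ ≤ R ^ (-s) * (3 * M) := by gcongr
          _ = _ := mul_comm _ _
      · exact Real.smoothTransition.monotone.deriv_nonneg
  have : r * ((1 + r ^ 2) ^ (-s / 2) * (deriv Real.smoothTransition (2 - r / R) * -(1 / R)))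
      = -((1 + r ^ 2) ^ (-s / 2) * (r / R * deriv Real.smoothTransition (2 - r / R))) := by
    ring
  rw [mul_add, this]
  linarith

end radialCutoff

/-- A nonnegative density of growth exponent `k < m` that satisfies the differential inequality
`∫ f (m η + r η') ≤ 0` for radial test functions vanishes almost everywhere. -/
lemma ae_eq_zero_of_radial_inequality {E : Type*} [NormedAddCommGroup E] [NormedSpace ℝ E]
    [FiniteDimensional ℝ E] [MeasurableSpace E] [BorelSpace E] {μ : Measure E}
    {f : E → ℝ} (hf : LocallyIntegrable f μ) (hf0 : ∀ x, 0 ≤ f x) {m k C : ℝ} (hk : 0 ≤ k)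
    (hkm : k < m)
    (hineq : ∀ η : ℝ → ℝ, ContDiff ℝ (⊤ : ℕ∞) η → (∀ r : ℝ, 0 ≤ r → 0 ≤ η r) →
      AntitoneOn η (Set.Ici (0 : ℝ)) → (∃ a : ℝ, ∀ r : ℝ, a ≤ r → η r = 0) →
      ∫ x, f x * (m * η ‖x‖ + ‖x‖ * deriv η ‖x‖) ∂μ ≤ 0)
    (hgrow : ∀ r : ℝ, 1 ≤ r → ∫ x in ball 0 r, f x ∂μ ≤ C * r ^ k) :
    f =ᵐ[μ] 0 := by
  obtain ⟨s, hks, hsm⟩ := exists_between hkm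
  have hs : 0 < s := hk.trans_lt hks
  obtain ⟨M, hM0, hM⟩ := exists_abs_deriv_smoothTransition_le
  have hball (r : ℝ) : IntegrableOn f (ball 0 r) μ :=
    (hf.integrableOn_isCompact (isCompact_closedBall 0 r)).mono_set ball_subset_closedBall
  have hbound (a R : ℝ) (ha : 0 < a) (hR : 1 ≤ R) (haR : a ≤ R) :
      (m - s) * (1 + a ^ 2) ^ (-s / 2) * ∫ x in ball 0 a, f x ∂μ
        ≤ 3 * M * C * 3 ^ k * R ^ (k - s) := by
    have hR0 : 0 < R := by linarith
    have htest := hineq (radialCutoff s R) contDiff_radialCutoff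
      (fun r _ => radialCutoff_nonneg r) (antitoneOn_radialCutoff hs.le hR0)
      ⟨2 * R, fun r hr => radialCutoff_eq_zero hR0 hr⟩
    have hcont : Continuous fun x : E =>
        m * radialCutoff s R ‖x‖ + ‖x‖ * deriv (radialCutoff s R) ‖x‖ := by
      have h1 : Continuous (radialCutoff s R) :=
        (contDiff_radialCutoff (m := 1)).continuous
      have h2 : Continuous (deriv (radialCutoff s R)) :=
        (contDiff_radialCutoff (m := 1)).continuous_deriv le_rfl
      fun_prop
    have hsupp : HasCompactSupport fun x : E =>
        m * radialCutoff s R ‖x‖ + ‖x‖ * deriv (radialCutoff s R) ‖x‖ := by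
      refine HasCompactSupport.intro (isCompact_closedBall 0 (3 * R)) fun x hx => ?_
      have hx : 3 * R < ‖x‖ := by simpa using hx
      rw [radialCutoff_eq_zero hR0 (by linarith), deriv_radialCutoff_eq_zero hR0 hx.le]
      simp
    have hint : Integrable (fun x => f x *
        (m * radialCutoff s R ‖x‖ + ‖x‖ * deriv (radialCutoff s R) ‖x‖)) μ := by
      simpa only [smul_eq_mul] using hf.integrable_smul_right_of_hasCompactSupport hcont hsupp
    set A := (m - s) * (1 + a ^ 2) ^ (-s / 2) with hA
    set B := 3 * M * R ^ (-s) with hB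
    have hA0 : 0 ≤ A := mul_nonneg (by linarith) (by positivity)
    have hB0 : 0 ≤ B := by positivity
    have hpt (x : E) : A * (ball 0 a).indicator f x ≤
        f x * (m * radialCutoff s R ‖x‖ + ‖x‖ * deriv (radialCutoff s R) ‖x‖)
          + B * (ball 0 (3 * R)).indicator f x := by
      have hη := radialCutoff_nonneg (s := s) (R := R) ‖x‖
      have hweight : A * (ball 0 a).indicator f x ≤ f x * ((m - s) * radialCutoff s R ‖x‖) := by
        by_cases hx : x ∈ ball (0 : E) a
        · have := le_radialCutoff hs.le hR0 (norm_nonneg x) (mem_ball_zero_iff.1 hx).le haR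
          rw [Set.indicator_of_mem hx, mul_comm]
          refine mul_le_mul_of_nonneg_left ?_ (hf0 x)
          exact mul_le_mul_of_nonneg_left this (by linarith)
        · rw [Set.indicator_of_notMem hx, mul_zero]
          exact mul_nonneg (hf0 x) (mul_nonneg (by linarith) hη)
      by_cases hx : x ∈ ball (0 : E) (3 * R)
      · have := neg_le_mul_deriv_radialCutoff hs.le hR0 hM0 hM (norm_nonneg x)
          (mem_ball_zero_iff.1 hx)
        rw [Set.indicator_of_mem hx]
        nlinarith [mul_le_mul_of_nonneg_left this (hf0 x)]
      · have hx' : 3 * R ≤ ‖x‖ := by simpa using hx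
        rw [radialCutoff_eq_zero hR0 (by linarith)] at hweight ⊢
        rw [Set.indicator_of_notMem hx, deriv_radialCutoff_eq_zero hR0 hx']
        simpa using hweight
    have hIa := ((hball a).integrable_indicator measurableSet_ball).const_mul A
    have hIR := ((hball (3 * R)).integrable_indicator measurableSet_ball).const_mul B
    have hmono := integral_mono hIa (hint.add hIR) hpt
    simp only [Pi.add_apply] at hmono
    rw [integral_add hint hIR, integral_const_mul, integral_const_mul,
      integral_indicator measurableSet_ball, integral_indicator measurableSet_ball] at hmono
    calc A * ∫ x in ball 0 a, f x ∂μ ≤ B * ∫ x in ball 0 (3 * R), f x ∂μ := by linarith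
      _ ≤ B * (C * (3 * R) ^ k) :=
          mul_le_mul_of_nonneg_left (hgrow _ (by linarith)) hB0
      _ = 3 * M * C * 3 ^ k * R ^ (k - s) := by
          rw [hB, Real.mul_rpow (by norm_num) hR0.le, sub_eq_add_neg, Real.rpow_add hR0]
          ring
  have hzero (a : ℝ) (ha : 0 < a) : ∫ x in ball 0 a, f x ∂μ ≤ 0 := by
    have hlim : Filter.Tendsto (fun R : ℝ => 3 * M * C * 3 ^ k * R ^ (k - s)) Filter.atTop
        (nhds 0) := by
      have h := (tendsto_rpow_neg_atTop (sub_pos.2 hks)).const_mul (3 * M * C * 3 ^ k)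
      simpa using h
    have hle := ge_of_tendsto hlim (by
      filter_upwards [Filter.eventually_ge_atTop 1, Filter.eventually_ge_atTop a] with R h1 h2
        using hbound a R ha h1 h2)
    have hpos : 0 < (m - s) * (1 + a ^ 2) ^ (-s / 2) :=
      mul_pos (sub_pos.2 hsm) (by positivity)
    exact nonpos_of_mul_nonpos_right hle hpos
  have hae (j : ℕ) : ∀ᵐ x ∂μ.restrict (ball 0 (j + 1 : ℝ)), f x = 0 := by
    have h := le_antisymm (hzero (j + 1) (by positivity)) (integral_nonneg hf0)
    exact (setIntegral_eq_zero_iff_of_nonneg_ae (Filter.Eventually.of_forall hf0) (hball _)).1 h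
  have hcover : ∀ᵐ x ∂μ, ∀ j : ℕ, x ∈ ball (0 : E) (j + 1 : ℝ) → f x = 0 :=
    ae_all_iff.2 fun j => (ae_restrict_iff' measurableSet_ball).1 (hae j)
  filter_upwards [hcover] with x hx
  obtain ⟨j, hj⟩ := exists_nat_gt ‖x‖
  exact hx j (mem_ball_zero_iff.2 (by linarith))

/-- Liouville theorem. If the energy of an r-stationary family of
alternating `q`-forms on `ℝⁿ` (with `ρ′ ≤ 0`, `ρ ≥ c > 0`, `q ≥ 1`, `n > 2q`) grows
no faster than `C·r^k` with `2q + k − n < 0`, then `Q = 0` almost everywhere. -/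
theorem stmt_4 (n q : ℕ) (hq : 1 ≤ q) (hn : 2 * q < n)
    (ρ : ℝ → ℝ) (hρC1 : ContDiff ℝ 1 ρ)
    (hρ0 : ∀ s : ℝ, 0 ≤ s → 0 ≤ ρ s)
    (hρ' : ∀ s : ℝ, 0 ≤ s → deriv ρ s ≤ 0)
    (c : ℝ) (hc : 0 < c) (hρc : ∀ s : ℝ, 0 ≤ s → c ≤ ρ s)
    (ω : EuclideanSpace ℝ (Fin n) → AlternatingMap ℝ (EuclideanSpace ℝ (Fin n)) ℝ (Fin q))
    (hωmeas : ∀ v : Fin q → EuclideanSpace ℝ (Fin n), Measurable fun x => ω x v)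
    (hint : LocallyIntegrable (fun x => hodgeE ρ (altNormSq (ω x))) volume)
    (hstat : ∀ η : ℝ → ℝ, ContDiff ℝ (⊤ : ℕ∞) η → (∀ r : ℝ, 0 ≤ r → 0 ≤ η r) →
      AntitoneOn η (Set.Ici (0:ℝ)) → (∃ a : ℝ, ∀ r : ℝ, a ≤ r → η r = 0) →
      (∫ x : EuclideanSpace ℝ (Fin n),
          hodgeE ρ (altNormSq (ω x)) * (n * η ‖x‖ + ‖x‖ * deriv η ‖x‖))
        = 2 * q * (∫ x : EuclideanSpace ℝ (Fin n),
              altNormSq (ω x) * ρ (altNormSq (ω x)) * η ‖x‖)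
          + 2 * q * ∫ x : EuclideanSpace ℝ (Fin n),
              ρ (altNormSq (ω x)) * ‖x‖ * deriv η ‖x‖ * contrNormSq (‖x‖⁻¹ • x) (ω x))
    (C k : ℝ) (hC : 0 < C) (hk : 0 ≤ k) (hkn : (2 * q : ℝ) + k - n < 0)
    (hgrow : ∀ r : ℝ, 1 ≤ r →
      (∫ x in ball (0 : EuclideanSpace ℝ (Fin n)) r, hodgeE ρ (altNormSq (ω x)))
        ≤ C * r ^ k) :
    ∀ᵐ x : EuclideanSpace ℝ (Fin n), altNormSq (ω x) = 0 := by
  have hanti : AntitoneOn ρ (Set.Ici 0) :=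
    antitoneOn_of_deriv_nonpos (convex_Ici 0) hρC1.continuous.continuousOn
      (hρC1.differentiable one_ne_zero).differentiableOn
      fun s hs => hρ' s (interior_subset hs)
  have hQ (x) : 0 ≤ altNormSq (ω x) := altNormSq_nonneg _
  have hle (x) : altNormSq (ω x) * ρ (altNormSq (ω x)) ≤ hodgeE ρ (altNormSq (ω x)) :=
    mul_le_hodgeE hρC1.continuous hanti (hQ x)
  have hQρ (x) : 0 ≤ altNormSq (ω x) * ρ (altNormSq (ω x)) := mul_nonneg (hQ x) (hρ0 _ (hQ x))
  have hzero := ae_eq_zero_of_radial_inequality (m := n - 2 * q) hint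
    (fun x => (hQρ x).trans (hle x)) hk (by linarith) (fun η hη hη0 hηanti hηsupp => ?_) hgrow
  · filter_upwards [hzero] with x hx
    have h : altNormSq (ω x) * ρ (altNormSq (ω x)) ≤ 0 := (hle x).trans hx.le
    exact le_antisymm (nonpos_of_mul_nonpos_left h (hc.trans_le (hρc _ (hQ x)))) (hQ x)
  obtain ⟨a, ha⟩ := hηsupp
  have hderiv (x : EuclideanSpace ℝ (Fin n)) : ‖x‖ * deriv η ‖x‖ ≤ 0 := by
    rcases (norm_nonneg x).eq_or_lt with h | h
    · simp [← h]
    · refine mul_nonpos_of_nonneg_of_nonpos h.le ?_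
      rw [← derivWithin_of_mem_nhds (Ici_mem_nhds h)]
      exact hηanti.derivWithin_nonpos
  have hderiv_zero {r : ℝ} (hr : a < r) : deriv η r = 0 := by
    have h : η =ᶠ[nhds r] fun _ => 0 := by
      filter_upwards [lt_mem_nhds hr] with x hx using ha x hx.le
    rw [h.deriv_eq, deriv_const]
  have hcontη : Continuous η := hη.continuous
  have hcontη' : Continuous (deriv η) := hη.continuous_deriv (by simp)
  have hint₁ : Integrable (fun x => hodgeE ρ (altNormSq (ω x)) *
      (n * η ‖x‖ + ‖x‖ * deriv η ‖x‖)) := by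
    refine hint.integrable_smul_right_of_hasCompactSupport (by fun_prop)
      (HasCompactSupport.intro (isCompact_closedBall 0 a) fun x hx => ?_)
    have hx : a < ‖x‖ := by simpa using hx
    simp [ha _ hx.le, hderiv_zero hx]
  have hint₂ : Integrable (fun x => hodgeE ρ (altNormSq (ω x)) * η ‖x‖) := by
    refine hint.integrable_smul_right_of_hasCompactSupport (by fun_prop)
      (HasCompactSupport.intro (isCompact_closedBall 0 a) fun x hx => ?_)
    have hx : a < ‖x‖ := by simpa using hx
    exact ha _ hx.le
  have hfirst : ∫ x, altNormSq (ω x) * ρ (altNormSq (ω x)) * η ‖x‖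
      ≤ ∫ x, hodgeE ρ (altNormSq (ω x)) * η ‖x‖ :=
    integral_mono_of_nonneg
      (Filter.Eventually.of_forall fun x => mul_nonneg (hQρ x) (hη0 _ (norm_nonneg x))) hint₂
      (Filter.Eventually.of_forall fun x =>
        mul_le_mul_of_nonneg_right (hle x) (hη0 _ (norm_nonneg x)))
  have hsecond : ∫ x : EuclideanSpace ℝ (Fin n),
      ρ (altNormSq (ω x)) * ‖x‖ * deriv η ‖x‖ * contrNormSq (‖x‖⁻¹ • x) (ω x) ≤ 0 := by
    refine integral_nonpos fun x => mul_nonpos_of_nonpos_of_nonneg ?_ (contrNormSq_nonneg _ _)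
    rw [mul_assoc]
    exact mul_nonpos_of_nonneg_of_nonpos (hρ0 _ (hQ x)) (hderiv x)
  have hsplit : ∫ x, hodgeE ρ (altNormSq (ω x)) * ((n - 2 * q) * η ‖x‖ + ‖x‖ * deriv η ‖x‖)
      = (∫ x, hodgeE ρ (altNormSq (ω x)) * (n * η ‖x‖ + ‖x‖ * deriv η ‖x‖))
        - 2 * q * ∫ x, hodgeE ρ (altNormSq (ω x)) * η ‖x‖ := by
    rw [← integral_const_mul, ← integral_sub hint₁ (hint₂.const_mul _)]
    congr 1 with x
    ring
  rw [hsplit, hstat η hη hη0 hηanti ⟨a, ha⟩]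
  have hq0 : (0 : ℝ) ≤ 2 * q := by positivity
  nlinarith [mul_le_mul_of_nonneg_left hfirst hq0, mul_nonneg hq0 (neg_nonneg.2 hsecond)]
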